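/- Let A be a C*-algebra acting on a Hilbert space H. Then the set Z(𝒫) of all central annihilators, with the order and operations inherited from 𝒫 and orthocomplementation V ↦ Ann(V), is a complete Boolean algebra; in particular, suprema and infima in 𝒫 of arbitrary families of central annihilators are again central. -/

import Mathlib

/-- The annihilator of a set `S`: elements anticommuting with every member of `S`. -/
def Ann {A : Type*} [NonUnitalNonAssocRing A] (S : Set A) : Set A :=
  {a : A | ∀ s ∈ S, a * s + s * a = 0}

/-- `ᵈV = {a ∈ A : x a y + y a x = 0 for all x, y ∈ V}`. -/
def dAnn {A : Type*} [NonUnitalNonAssocRing A] (V : Set A) : Set A :=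
  {a : A | ∀ x ∈ V, ∀ y ∈ V, x * a * y + y * a * x = 0}

/-- The set `𝒫` of annihilators: sets of the form `Ann (Ann S)` with `S ⊆ A₊`. -/
def PAnn (A : Type*) [NonUnitalNonAssocRing A] [PartialOrder A] : Set (Set A) :=
  {V | ∃ S : Set A, (∀ s ∈ S, 0 ≤ s) ∧ V = Ann (Ann S)}

/-- A central annihilator: `V = Ann (Ann S)` with `S ⊆ A₊` and
`ᵈ(Ann (Ann S)) ∩ ᵈ(Ann S) = {0}`. -/
def IsCentralAnn {A : Type*} [NonUnitalNonAssocRing A] [PartialOrder A] (V : Set A) : Prop :=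
  ∃ S : Set A, (∀ s ∈ S, 0 ≤ s) ∧ V = Ann (Ann S) ∧
    dAnn (Ann (Ann S)) ∩ dAnn (Ann S) = {0}

/-- `V` is the least upper bound of the family `T` within the collection `P` (ordered by `⊆`). -/
def IsLUBIn {α : Type*} (P T : Set (Set α)) (V : Set α) : Prop :=
  V ∈ P ∧ (∀ W ∈ T, W ⊆ V) ∧ ∀ U ∈ P, (∀ W ∈ T, W ⊆ U) → V ⊆ U

/-- `V` is the greatest lower bound of the family `T` within the collection `P`. -/
def IsGLBIn {α : Type*} (P T : Set (Set α)) (V : Set α) : Prop :=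
  V ∈ P ∧ (∀ W ∈ T, V ⊆ W) ∧ ∀ U ∈ P, (∀ W ∈ T, U ⊆ W) → U ⊆ V

theorem subset_Ann_Ann {A : Type*} [NonUnitalNonAssocRing A] (S : Set A) :
    S ⊆ Ann (Ann S) := fun s hs a ha => by
  rw [add_comm]
  exact ha s hs

theorem Ann_antitone {A : Type*} [NonUnitalNonAssocRing A] {S T : Set A} (h : S ⊆ T) :
    Ann T ⊆ Ann S := fun _ ha s hs => ha s (h hs)

theorem Ann_Ann_Ann {A : Type*} [NonUnitalNonAssocRing A] (S : Set A) :
    Ann (Ann (Ann S)) = Ann S :=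
  (Ann_antitone (subset_Ann_Ann S)).antisymm (subset_Ann_Ann _)

/-- Sets stable under the involution and under multiplication by arbitrary elements. -/
structure IsStarMulAbsorbing {A : Type*} [Mul A] [Star A] (I : Set A) : Prop where
  star_mem : ∀ s ∈ I, star s ∈ I
  mul_left_mem : ∀ x, ∀ s ∈ I, x * s ∈ I
  mul_right_mem : ∀ x, ∀ s ∈ I, s * x ∈ I

theorem IsStarMulAbsorbing.sInter {A : Type*} [Mul A] [Star A] {T : Set (Set A)}
    (hT : ∀ W ∈ T, IsStarMulAbsorbing W) : IsStarMulAbsorbing (⋂₀ T) where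
  star_mem s hs W hW := (hT W hW).star_mem s (hs W hW)
  mul_left_mem x s hs W hW := (hT W hW).mul_left_mem x s (hs W hW)
  mul_right_mem x s hs W hW := (hT W hW).mul_right_mem x s (hs W hW)

theorem IsStarMulAbsorbing.sUnion {A : Type*} [Mul A] [Star A] {T : Set (Set A)}
    (hT : ∀ W ∈ T, IsStarMulAbsorbing W) : IsStarMulAbsorbing (⋃₀ T) where
  star_mem := fun s ⟨W, hW, hs⟩ => ⟨W, hW, (hT W hW).star_mem s hs⟩
  mul_left_mem := fun x s ⟨W, hW, hs⟩ => ⟨W, hW, (hT W hW).mul_left_mem x s hs⟩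
  mul_right_mem := fun x s ⟨W, hW, hs⟩ => ⟨W, hW, (hT W hW).mul_right_mem x s hs⟩

theorem IsStarMulAbsorbing.inter {A : Type*} [Mul A] [Star A] {I J : Set A}
    (hI : IsStarMulAbsorbing I) (hJ : IsStarMulAbsorbing J) : IsStarMulAbsorbing (I ∩ J) where
  star_mem s hs := ⟨hI.star_mem s hs.1, hJ.star_mem s hs.2⟩
  mul_left_mem x s hs := ⟨hI.mul_left_mem x s hs.1, hJ.mul_left_mem x s hs.2⟩
  mul_right_mem x s hs := ⟨hI.mul_right_mem x s hs.1, hJ.mul_right_mem x s hs.2⟩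

section CStarAlgebra

variable {A : Type*} [NonUnitalCStarAlgebra A]

theorem eq_zero_of_add_self_eq_zero {a : A} (h : a + a = 0) : a = 0 := by
  rw [← two_smul ℝ] at h
  exact (smul_eq_zero.1 h).resolve_left two_ne_zero

theorem mul_eq_zero_of_mul_mul_star_eq_zero {b a : A} (h : b * (a * star a) = 0) :
    b * a = 0 := by
  rw [← CStarRing.mul_star_self_eq_zero_iff, star_mul,
    show b * a * (star a * star b) = b * (a * star a) * star b by simp only [mul_assoc], h,
    zero_mul]

theorem mul_eq_zero_of_star_mul_mul_eq_zero {a b : A} (h : star a * a * b = 0) :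
    a * b = 0 := by
  rw [← CStarRing.star_mul_self_eq_zero_iff, star_mul,
    show star b * star a * (a * b) = star b * (star a * a * b) by simp only [mul_assoc], h,
    mul_zero]

namespace IsStarMulAbsorbing

theorem mul_eq_zero_of_mem_Ann {I : Set A} (hI : IsStarMulAbsorbing I) {a : A} (ha : a ∈ Ann I)
    {t : A} (ht : t ∈ I) : t * a = 0 := by
  have h : ∀ s ∈ I, s * (t * a) = 0 := fun s hs => by
    have h1 := ha (s * t) (hI.mul_left_mem s t ht)
    have h2 : a * s * t = -(s * a * t) := by rw [eq_neg_of_add_eq_zero_left (ha s hs), neg_mul]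
    have h3 : s * (a * t) = -(s * (t * a)) := by
      rw [eq_neg_of_add_eq_zero_left (ha t ht), mul_neg]
    refine eq_zero_of_add_self_eq_zero ?_
    rw [← mul_assoc, h2, mul_assoc s a, h3, neg_neg, mul_assoc s t] at h1
    exact h1
  rw [← CStarRing.star_mul_self_eq_zero_iff]
  exact h _ (hI.star_mem _ (hI.mul_right_mem a t ht))

theorem mem_Ann_of_mul_eq_zero {I : Set A} (hI : IsStarMulAbsorbing I) {a : A}
    (ha : ∀ t ∈ I, t * a = 0) : a ∈ Ann I := fun t ht => by
  rw [ha t ht, add_zero, ← CStarRing.star_mul_self_eq_zero_iff, ← mul_assoc,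
    ha _ (hI.star_mem _ (hI.mul_left_mem a t ht)), zero_mul]

theorem mul_eq_zero_of_mem_Ann' {I : Set A} (hI : IsStarMulAbsorbing I) {a : A} (ha : a ∈ Ann I)
    {t : A} (ht : t ∈ I) : a * t = 0 := by
  have h := ha t ht
  rwa [hI.mul_eq_zero_of_mem_Ann ha ht, add_zero] at h

theorem eq_zero_of_mem_of_mem_Ann {I : Set A} (hI : IsStarMulAbsorbing I) {a : A} (ha : a ∈ I)
    (ha' : a ∈ Ann I) : a = 0 := by
  rw [← CStarRing.star_mul_self_eq_zero_iff]
  exact hI.mul_eq_zero_of_mem_Ann ha' (hI.star_mem a ha)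

theorem ann {I : Set A} (hI : IsStarMulAbsorbing I) : IsStarMulAbsorbing (Ann I) where
  star_mem a ha := hI.mem_Ann_of_mul_eq_zero fun t ht => by
    rw [← star_star t, ← star_mul, hI.mul_eq_zero_of_mem_Ann' ha (hI.star_mem t ht), star_zero]
  mul_left_mem x a ha := hI.mem_Ann_of_mul_eq_zero fun t ht => by
    rw [← mul_assoc, hI.mul_eq_zero_of_mem_Ann ha (hI.mul_right_mem x t ht)]
  mul_right_mem x a ha := hI.mem_Ann_of_mul_eq_zero fun t ht => by
    rw [← mul_assoc, hI.mul_eq_zero_of_mem_Ann ha ht, zero_mul]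

theorem mem_Ann_of_mem_dAnn {I : Set A} (hI : IsStarMulAbsorbing I) {a : A} (ha : a ∈ dAnn I) :
    a ∈ Ann I := by
  have h1 : ∀ x ∈ I, ∀ y ∈ I, x * (x * a) * y = 0 := fun x hx y hy => by
    have e1 := eq_neg_of_add_eq_zero_left (ha x hx y hy)
    have e2 := ha (x * y) (hI.mul_left_mem x y hy) x hx
    have e3 := eq_zero_of_add_self_eq_zero (ha x hx x hx)
    rw [← mul_assoc, e3, zero_mul, add_zero] at e2
    rw [mul_assoc x, e1, mul_neg, ← mul_assoc, ← mul_assoc, e2, neg_zero]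
  have h2 : ∀ x ∈ I, x * (x * a) = 0 := fun x hx => by
    rw [← CStarRing.mul_star_self_eq_zero_iff]
    exact h1 x hx _ (hI.star_mem _ (hI.mul_left_mem _ _ (hI.mul_right_mem _ _ hx)))
  refine hI.mem_Ann_of_mul_eq_zero fun v hv => ?_
  have h3 := h2 _ (hI.mul_left_mem (star v) v hv)
  rw [← mul_assoc] at h3
  refine mul_eq_zero_of_star_mul_mul_eq_zero (mul_eq_zero_of_star_mul_mul_eq_zero ?_)
  rwa [star_mul, star_star]

end IsStarMulAbsorbing

variable [PartialOrder A]

theorem IsCentralAnn.mem_PAnn {V : Set A} (hV : IsCentralAnn V) : V ∈ PAnn A := by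
  obtain ⟨S, hS, h, -⟩ := hV
  exact ⟨S, hS, h⟩

theorem Ann_Ann_eq_of_mem_PAnn {V : Set A} (hV : V ∈ PAnn A) : Ann (Ann V) = V := by
  obtain ⟨S, -, rfl⟩ := hV
  exact Ann_Ann_Ann _

variable [StarOrderedRing A]

theorem mul_eq_zero_of_nonneg_of_anticommute {a s : A} (hs : 0 ≤ s) (h : a * s + s * a = 0) :
    a * s = 0 := by
  have h1 : a * s = -(s * a) := eq_neg_of_add_eq_zero_left h
  have hc : Commute (s * s) a := by
    change s * s * a = a * (s * s)
    rw [← mul_assoc, h1, neg_mul, mul_assoc s a, h1, mul_neg, neg_neg, mul_assoc]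
  have hc' : Commute (CFC.sqrt (s * s)) a := hc.cfcₙ_nnreal _
  rw [CFC.sqrt_mul_self s hs] at hc'
  rw [← hc'.eq] at h
  rw [← hc'.eq]
  exact eq_zero_of_add_self_eq_zero h

theorem mem_Ann_iff_of_nonneg {S : Set A} (hS : ∀ s ∈ S, 0 ≤ s) {a : A} :
    a ∈ Ann S ↔ ∀ s ∈ S, a * s = 0 ∧ s * a = 0 := by
  refine ⟨fun ha s hs => ?_, fun ha s hs => by rw [(ha s hs).1, (ha s hs).2, add_zero]⟩
  have h := ha s hs
  have h1 := mul_eq_zero_of_nonneg_of_anticommute (hS s hs) h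
  exact ⟨h1, by rwa [h1, zero_add] at h⟩

theorem star_mem_Ann_of_nonneg {S : Set A} (hS : ∀ s ∈ S, 0 ≤ s) {a : A} (ha : a ∈ Ann S) :
    star a ∈ Ann S := by
  rw [mem_Ann_iff_of_nonneg hS] at ha ⊢
  intro s hs
  have e : star s = s := IsSelfAdjoint.of_nonneg (hS s hs)
  constructor
  · rw [← e, ← star_mul, (ha s hs).2, star_zero]
  · rw [← e, ← star_mul, (ha s hs).1, star_zero]

theorem mem_Ann_Ann_iff_of_nonneg {S : Set A} (hS : ∀ s ∈ S, 0 ≤ s) {b : A} :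
    b ∈ Ann (Ann S) ↔ ∀ a ∈ Ann S, b * a = 0 ∧ a * b = 0 := by
  refine ⟨fun hb a ha => ?_, fun hb a ha => by rw [(hb a ha).1, (hb a ha).2, add_zero]⟩
  have ha' := (mem_Ann_iff_of_nonneg hS).1 ha
  have hs' := (mem_Ann_iff_of_nonneg hS).1 (star_mem_Ann_of_nonneg hS ha)
  have key : ∀ c ∈ Ann S, 0 ≤ c → b * c = 0 ∧ c * b = 0 := fun c hc h0 =>
    (mem_Ann_iff_of_nonneg (S := {c}) (by simpa using h0)).1
      (fun s hs => hb s (by rwa [Set.mem_singleton_iff.1 hs])) c rfl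
  constructor
  · refine mul_eq_zero_of_mul_mul_star_eq_zero (key _ ?_ (mul_star_self_nonneg a)).1
    exact (mem_Ann_iff_of_nonneg hS).2 fun s hs =>
      ⟨by rw [mul_assoc, (hs' s hs).1, mul_zero], by rw [← mul_assoc, (ha' s hs).2, zero_mul]⟩
  · refine mul_eq_zero_of_star_mul_mul_eq_zero (key _ ?_ (star_mul_self_nonneg a)).2
    exact (mem_Ann_iff_of_nonneg hS).2 fun s hs =>
      ⟨by rw [mul_assoc, (ha' s hs).1, mul_zero], by rw [← mul_assoc, (hs' s hs).2, zero_mul]⟩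

theorem IsCentralAnn.isStarMulAbsorbing {V : Set A} (hV : IsCentralAnn V) :
    IsStarMulAbsorbing V := by
  obtain ⟨S, hS, rfl, h0⟩ := hV
  have hstar : ∀ c ∈ Ann (Ann S), star c ∈ Ann (Ann S) := fun c hc => by
    rw [mem_Ann_Ann_iff_of_nonneg hS] at hc ⊢
    intro b hb
    have h := hc _ (star_mem_Ann_of_nonneg hS hb)
    constructor
    · rw [← star_star b, ← star_mul, h.2, star_zero]
    · rw [← star_star b, ← star_mul, h.1, star_zero]
  have hz : ∀ c ∈ Ann (Ann S), ∀ b ∈ Ann S, ∀ x, c * x * b = 0 := fun c hc b hb x => by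
    have hmul : ∀ u ∈ Ann (Ann S), ∀ v ∈ Ann S, u * v = 0 ∧ v * u = 0 := fun u hu =>
      (mem_Ann_Ann_iff_of_nonneg hS).1 hu
    have : c * x * b ∈ dAnn (Ann (Ann S)) ∩ dAnn (Ann S) := by
      constructor
      · intro u hu v hv
        rw [mul_assoc u, mul_assoc (c * x), (hmul v hv b hb).2, mul_assoc v, mul_assoc (c * x),
          (hmul u hu b hb).2]
        simp
      · intro u hu v hv
        simp only [← mul_assoc]
        rw [(hmul c hc u hu).2, (hmul c hc v hv).2]
        simp
    rwa [h0] at this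
  have hz' : ∀ c ∈ Ann (Ann S), ∀ b ∈ Ann S, ∀ x, b * x * c = 0 := fun c hc b hb x => by
    have h := hz _ (hstar c hc) _ (star_mem_Ann_of_nonneg hS hb) (star x)
    rw [← star_eq_zero, star_mul, star_mul, ← mul_assoc, h]
  refine ⟨hstar, fun x c hc => ?_, fun x c hc => ?_⟩
  all_goals
    rw [mem_Ann_Ann_iff_of_nonneg hS]
    intro b hb
    have h := (mem_Ann_Ann_iff_of_nonneg hS).1 hc b hb
  · exact ⟨by rw [mul_assoc, h.1, mul_zero], by rw [← mul_assoc, hz' c hc b hb]⟩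
  · exact ⟨hz c hc b hb x, by rw [← mul_assoc, h.2, zero_mul]⟩

theorem IsStarMulAbsorbing.isCentralAnn {V : Set A} (hV : IsStarMulAbsorbing V)
    (h : Ann (Ann V) ⊆ V) : IsCentralAnn V := by
  have hS : ∀ s ∈ {s ∈ V | 0 ≤ s}, 0 ≤ s := fun s hs => hs.2
  have hAnn : Ann {s ∈ V | 0 ≤ s} = Ann V := by
    refine Set.Subset.antisymm (fun a ha v hv => ?_) (Ann_antitone fun s hs => hs.1)
    rw [mem_Ann_iff_of_nonneg hS] at ha
    rw [mul_eq_zero_of_mul_mul_star_eq_zero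
        (ha _ ⟨hV.mul_right_mem _ v hv, mul_star_self_nonneg v⟩).1,
      mul_eq_zero_of_star_mul_mul_eq_zero
        (ha _ ⟨hV.mul_left_mem _ v hv, star_mul_self_nonneg v⟩).2, add_zero]
  refine ⟨_, hS, ?_, ?_⟩
  · rw [hAnn]
    exact (subset_Ann_Ann V).antisymm h
  · rw [hAnn, h.antisymm (subset_Ann_Ann V)]
    refine Set.Subset.antisymm (fun a ha => ?_) ?_
    · exact hV.eq_zero_of_mem_of_mem_Ann (h (hV.ann.mem_Ann_of_mem_dAnn ha.2))
        (hV.mem_Ann_of_mem_dAnn ha.1)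
    · rintro _ rfl
      constructor <;> intro x _ y _ <;> simp

theorem IsStarMulAbsorbing.isCentralAnn_Ann {I : Set A} (hI : IsStarMulAbsorbing I) :
    IsCentralAnn (Ann I) :=
  hI.ann.isCentralAnn (Ann_Ann_Ann I).subset

theorem isCentralAnn_sInter {T : Set (Set A)} (hT : ∀ W ∈ T, IsCentralAnn W) :
    IsCentralAnn (⋂₀ T) :=
  (IsStarMulAbsorbing.sInter fun W hW => (hT W hW).isStarMulAbsorbing).isCentralAnn
    fun a ha W hW => by
      rw [← Ann_Ann_eq_of_mem_PAnn (hT W hW).mem_PAnn]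
      exact Ann_antitone (Ann_antitone (Set.sInter_subset_of_mem hW)) ha

theorem IsCentralAnn.inter_subset_iff {V W U : Set A} (hV : IsCentralAnn V) (hW : IsCentralAnn W)
    (hU : IsCentralAnn U) : V ∩ W ⊆ U ↔ W ⊆ Ann (V ∩ Ann U) := by
  have hD := hV.isStarMulAbsorbing.inter hU.isStarMulAbsorbing.ann
  constructor
  · intro h w hw
    refine hD.mem_Ann_of_mul_eq_zero fun d hd => ?_
    exact hU.isStarMulAbsorbing.eq_zero_of_mem_of_mem_Ann
      (h ⟨hV.isStarMulAbsorbing.mul_right_mem w d hd.1,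
        hW.isStarMulAbsorbing.mul_left_mem d w hw⟩)
      (hU.isStarMulAbsorbing.ann.mul_right_mem w d hd.2)
  · rintro h a ⟨haV, haW⟩
    rw [← Ann_Ann_eq_of_mem_PAnn hU.mem_PAnn]
    refine hU.isStarMulAbsorbing.ann.mem_Ann_of_mul_eq_zero fun c hc => ?_
    exact hD.eq_zero_of_mem_of_mem_Ann
      ⟨hV.isStarMulAbsorbing.mul_left_mem c a haV,
        hU.isStarMulAbsorbing.ann.mul_right_mem a c hc⟩
      (hD.ann.mul_left_mem c a (h haW))

/-- Central annihilators form a complete lattice, with intersections as infima. -/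
noncomputable abbrev centralAnnCompleteLattice : CompleteLattice {V : Set A // IsCentralAnn V} :=
  letI : InfSet {V : Set A // IsCentralAnn V} :=
    ⟨fun T => ⟨⋂₀ (Subtype.val '' T), isCentralAnn_sInter (by rintro _ ⟨W, -, rfl⟩; exact W.2)⟩⟩
  completeLatticeOfInf _ fun T =>
    ⟨fun W hW => Set.sInter_subset_of_mem (Set.mem_image_of_mem _ hW),
      fun U hU => Set.subset_sInter (by rintro _ ⟨W, hW, rfl⟩; exact hU hW)⟩

/-- Central annihilators form a complete Boolean algebra with complement `Ann`. -/
noncomputable abbrev centralAnnCompleteBooleanAlgebra :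
    CompleteBooleanAlgebra {V : Set A // IsCentralAnn V} :=
  letI : CompleteLattice {V : Set A // IsCentralAnn V} := centralAnnCompleteLattice
  have inf_le (V W U : {V : Set A // IsCentralAnn V}) :
      V ⊓ W ≤ U ↔ W.1 ⊆ Ann (V.1 ∩ Ann U.1) := by
    rw [← IsCentralAnn.inter_subset_iff V.2 W.2 U.2]
    have hVW : IsCentralAnn (V.1 ∩ W.1) := by
      rw [← Set.sInter_pair]
      exact isCentralAnn_sInter (by rintro _ (rfl | rfl); exacts [V.2, W.2])
    have hle : (⟨_, hVW⟩ : {V : Set A // IsCentralAnn V}) ≤ V ⊓ W :=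
      le_inf Set.inter_subset_left Set.inter_subset_right
    exact ⟨fun h => hle.trans h, fun h a ha =>
      h ⟨inf_le_left (a := V) (b := W) ha, inf_le_right (a := V) (b := W) ha⟩⟩
  have le_himp (V W U : {V : Set A // IsCentralAnn V}) :
      V ⊓ W ≤ U ↔ W ≤ ⟨_, (V.2.isStarMulAbsorbing.inter
        U.2.isStarMulAbsorbing.ann).isCentralAnn_Ann⟩ := inf_le V W U
  { centralAnnCompleteLattice (A := A) with
    compl := fun V => ⟨Ann V.1, V.2.isStarMulAbsorbing.isCentralAnn_Ann⟩
    le_sup_inf := fun x y z => by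
      change (x ⊔ y) ⊓ (x ⊔ z) ≤ x ⊔ (y ⊓ z)
      rw [le_himp, sup_le_iff, ← le_himp, ← le_himp]
      refine ⟨inf_le_right.trans le_sup_left, ?_⟩
      rw [inf_comm, le_himp, sup_le_iff, ← le_himp, ← le_himp]
      exact ⟨inf_le_right.trans le_sup_left, inf_comm z y ▸ le_sup_right⟩
    inf_compl_le_bot := fun V => by
      change V ⊓ _ ≤ ⊥
      rw [le_himp]
      exact Ann_antitone Set.inter_subset_left
    top_le_sup_compl := fun V => by
      change ⊤ ≤ V ⊔ (⟨Ann V.1, V.2.isStarMulAbsorbing.isCentralAnn_Ann⟩ :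
        {V : Set A // IsCentralAnn V})
      generalize hU : V ⊔ (⟨Ann V.1, V.2.isStarMulAbsorbing.isCentralAnn_Ann⟩ :
        {V : Set A // IsCentralAnn V}) = U
      have h1 : V.1 ⊆ U.1 := (le_sup_left.trans_eq hU : V ≤ U)
      have h2 : Ann V.1 ⊆ U.1 := (le_sup_right.trans_eq hU : ⟨Ann V.1, _⟩ ≤ U)
      intro a _
      rw [← Ann_Ann_eq_of_mem_PAnn U.2.mem_PAnn]
      intro c hc
      rw [V.2.isStarMulAbsorbing.ann.eq_zero_of_mem_of_mem_Ann (Ann_antitone h1 hc)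
        (Ann_antitone h2 hc), mul_zero, zero_mul, add_zero] }

end CStarAlgebra

/-- The set `Z(𝒫)` of central annihilators, ordered by inclusion and with
orthocomplementation `V ↦ Ann V`, is a complete Boolean algebra; in particular suprema and
infima (taken in `𝒫`) of families of central annihilators are again central. -/
theorem stmt_7 {A : Type*} [NonUnitalCStarAlgebra A] [PartialOrder A] [StarOrderedRing A] :
    (∃ inst : CompleteBooleanAlgebra {V : Set A // IsCentralAnn V},
      (∀ V W : {V : Set A // IsCentralAnn V}, inst.le V W ↔ (V : Set A) ⊆ (W : Set A)) ∧
      (∀ V : {V : Set A // IsCentralAnn V}, ((inst.compl V) : Set A) = Ann (V : Set A))) ∧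
    (∀ T ⊆ {V : Set A | IsCentralAnn V}, ∀ V, IsLUBIn (PAnn A) T V → IsCentralAnn V) ∧
    (∀ T ⊆ {V : Set A | IsCentralAnn V}, ∀ V, IsGLBIn (PAnn A) T V → IsCentralAnn V) := by
  refine ⟨⟨centralAnnCompleteBooleanAlgebra, fun V W => Iff.rfl, fun V => rfl⟩, ?_, ?_⟩
  · intro T hT V hV
    have hI := IsStarMulAbsorbing.sUnion fun W hW => (hT hW).isStarMulAbsorbing
    have hL := hI.ann.isCentralAnn_Ann
    have : V = Ann (Ann (⋃₀ T)) := by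
      refine (hV.2.2 _ hL.mem_PAnn fun W hW =>
        (Set.subset_sUnion_of_mem hW).trans (subset_Ann_Ann _)).antisymm ?_
      rw [← Ann_Ann_eq_of_mem_PAnn hV.1]
      exact Ann_antitone (Ann_antitone (Set.sUnion_subset hV.2.1))
    rwa [this]
  · intro T hT V hV
    have hL := isCentralAnn_sInter fun W hW => hT hW
    have : V = ⋂₀ T := (Set.subset_sInter hV.2.1).antisymm
      (hV.2.2 _ hL.mem_PAnn fun W hW => Set.sInter_subset_of_mem hW)
    rwa [this]
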